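/- Let k be a field of characteristic zero, let d ≥ 3, and let q, r be integers with 2d−2 ≤ q < r. In the coordinates Z_0,…,Z_q, Y_{q+1},…,Y_r on P^r, let G* = Z_{2d−3}^{2d−1} Y_r + Σ_{i=0}^{2d−4} Z_i^{i+2} Y_r^{2d−2−i}, let β* be the point with Y_r-coordinate 1 and all other coordinates 0, and let M_0 be the linear subspace defined by Z_{2d−1} = … = Z_q = Y_{q+1} = … = Y_r = 0. Then the point η* ∈ M_0 whose only nonzero coordinate is Z_{2d−2} satisfies G*(η*) = 0 and Δ^j_{η*}(G*)(β*) = 0 for every j = 1,…,2d−2; and conversely, η* is the unique point of M_0 with these properties: any point η ∈ M_0 with G*(η) = 0 and Δ^j_η(G*)(β*) = 0 for all j = 1,…,2d−2 is projectively equal to η*. -/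

import Mathlib

set_option synthInstance.maxHeartbeats 1000000
set_option maxHeartbeats 1000000

universe u

/-- The `j`-th polar of the point `η` with respect to the (homogeneous) polynomial `G`:
the polynomial in `X = (X_0, …, X_{n-1})` obtained by applying the derivation
`X_0 ∂/∂U_0 + … + X_{n-1} ∂/∂U_{n-1}` to `G(U)` `j` times and then evaluating at
`U = η`. -/
noncomputable def polar {R : Type*} [CommRing R] {n : ℕ}
    (G : MvPolynomial (Fin n) R) (η : Fin n → R) (j : ℕ) : MvPolynomial (Fin n) R :=
  MvPolynomial.aeval (Sum.elim (fun i => MvPolynomial.C (η i)) MvPolynomial.X)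
    ((fun p => ∑ i : Fin n,
        MvPolynomial.X (Sum.inr i) * MvPolynomial.pderiv (Sum.inl i) p)^[j]
      (MvPolynomial.rename Sum.inl G))

open MvPolynomial in
lemma psi_pderiv {R : Type*} [CommRing R] {n : ℕ} (β : Fin n → R) (i : Fin n)
    (p : MvPolynomial (Fin n ⊕ Fin n) R) :
    aeval (Sum.elim X (fun i => C (β i)) : Fin n ⊕ Fin n → MvPolynomial (Fin n) R)
      (pderiv (Sum.inl i) p) =
    pderiv i (aeval (Sum.elim X (fun i => C (β i)) : Fin n ⊕ Fin n → MvPolynomial (Fin n) R) p) := by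
  classical
  induction p using MvPolynomial.induction_on with
  | C a => simp [algebraMap_eq]
  | add p q hp hq => simp only [map_add, hp, hq]
  | mul_X p s hp =>
    rw [Derivation.leibniz, map_mul, Derivation.leibniz, map_add]
    simp only [smul_eq_mul, map_mul, hp]
    rcases s with s | s
    · by_cases h : s = i
      · subst h; simp
      · have h2 : (Sum.inl s : Fin n ⊕ Fin n) ≠ Sum.inl i := by simpa using h
        simp [pderiv_X_of_ne h, pderiv_X_of_ne h2]
    · have h2 : (Sum.inr s : Fin n ⊕ Fin n) ≠ Sum.inl i := by simp
      simp [pderiv_X_of_ne h2]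

open MvPolynomial in
lemma eval_polar {R : Type*} [CommRing R] {r : ℕ} (G : MvPolynomial (Fin (r+1)) R)
    (η : Fin (r+1) → R) (j : ℕ) (hr : r < r + 1) :
    eval (fun i : Fin (r + 1) => if (i : ℕ) = r then 1 else 0) (polar G η j) =
    eval η (((pderiv (⟨r, hr⟩ : Fin (r+1)) : Derivation R _ _).toLinearMap ^ j) G) := by
  set β : Fin (r+1) → R := fun i => if (i : ℕ) = r then 1 else 0 with hβ
  unfold polar
  have h1 : ∀ p : MvPolynomial (Fin (r+1) ⊕ Fin (r+1)) R,
      eval β (aeval (Sum.elim (fun i => C (η i)) X) p) =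
      eval η (aeval (Sum.elim X (fun i => C (β i)) :
        Fin (r+1) ⊕ Fin (r+1) → MvPolynomial (Fin (r+1)) R) p) := by
    intro p
    induction p using MvPolynomial.induction_on with
    | C a => simp [algebraMap_eq]
    | add p q hp hq => simp only [map_add, hp, hq]
    | mul_X p s hp =>
      rw [map_mul, map_mul, map_mul, map_mul, hp]
      rcases s with s | s <;> simp
  rw [h1]
  congr 1
  induction j with
  | zero =>
    simp only [Function.iterate_zero, id, pow_zero, aeval_rename]
    have : (Sum.elim X (fun i => C (β i)) : Fin (r+1) ⊕ Fin (r+1) → MvPolynomial (Fin (r+1)) R)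
      ∘ Sum.inl = X := by ext1; simp
    rw [this]; simp
  | succ j ih =>
    rw [Function.iterate_succ_apply', pow_succ', Module.End.mul_apply, ← ih, map_sum]
    simp only [map_mul, psi_pderiv]
    rw [Finset.sum_eq_single (⟨r, hr⟩ : Fin (r+1))]
    · simp [hβ]
    · intro b _ hb
      have : (b : ℕ) ≠ r := fun h => hb (Fin.ext h)
      simp [hβ, this]
    · simp

open MvPolynomial in
lemma iter_pderiv {R : Type*} [CommRing R] {n : ℕ} (a b : Fin n) (hab : a ≠ b) (m e j : ℕ) :
    ((pderiv b : Derivation R (MvPolynomial (Fin n) R) _).toLinearMap ^ j) (X a ^ m * X b ^ e) =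
    (e.descFactorial j : MvPolynomial (Fin n) R) * (X a ^ m * X b ^ (e - j)) := by
  induction j with
  | zero => simp
  | succ j ih =>
    rw [pow_succ', Module.End.mul_apply, ih, Nat.descFactorial_succ]
    simp [Derivation.leibniz, Derivation.leibniz_pow, pderiv_X_of_ne hab, Nat.sub_sub]
    ring

open MvPolynomial in
lemma eval_iter {R : Type*} [CommRing R] {n : ℕ} (a b : Fin n) (hab : a ≠ b) (m e j : ℕ)
    (η : Fin n → R) (hη : η b = 0) :
    eval η (((pderiv b : Derivation R (MvPolynomial (Fin n) R) _).toLinearMap ^ j)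
      (X a ^ m * X b ^ e)) = if j = e then (j.factorial : R) * η a ^ m else 0 := by
  rw [iter_pderiv a b hab]
  split_ifs with h
  · subst h; simp [Nat.descFactorial_self]
  · rcases lt_or_gt_of_ne h with h | h
    · have : e - j ≠ 0 := by omega
      simp [hη, this]
    · simp [Nat.descFactorial_of_lt h]

open MvPolynomial in
lemma eval_polar_G {k : Type u} [Field k] (d q r : ℕ)
    (hd : 3 ≤ d) (hdq : 2 * d - 2 ≤ q) (hqr : q < r) (η : Fin (r + 1) → k)
    (h1 : 2 * d - 3 < r + 1)
    (h2 : r < r + 1) (h3 : ∀ i : Fin (2 * d - 3), (i : ℕ) < r + 1) (hη : η ⟨r, h2⟩ = 0) (j : ℕ) :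
    MvPolynomial.eval (fun i : Fin (r + 1) => if (i : ℕ) = r then 1 else 0)
          (polar
            ((MvPolynomial.X (⟨2 * d - 3, h1⟩ : Fin (r + 1))) ^ (2 * d - 1) *
                MvPolynomial.X (⟨r, h2⟩ : Fin (r + 1)) +
              ∑ i : Fin (2 * d - 3),
                (MvPolynomial.X (⟨(i : ℕ), h3 i⟩ : Fin (r + 1)))
                    ^ ((i : ℕ) + 2) *
                  MvPolynomial.X (⟨r, h2⟩ : Fin (r + 1))
                    ^ (2 * d - 2 - (i : ℕ)) : MvPolynomial (Fin (r + 1)) k)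
            η j) =
    (if j = 1 then (j.factorial : k) * η ⟨2 * d - 3, h1⟩ ^ (2 * d - 1) else 0) +
    ∑ i : Fin (2 * d - 3), if j = 2 * d - 2 - (i : ℕ) then
      (j.factorial : k) * η ⟨(i : ℕ), h3 i⟩ ^ ((i : ℕ) + 2) else 0 := by
  rw [eval_polar _ _ _ h2, map_add, map_add, map_sum, map_sum]
  congr 1
  · have := eval_iter (⟨2 * d - 3, h1⟩ : Fin (r+1)) ⟨r, h2⟩
      (by simp only [ne_eq, Fin.mk.injEq]; omega) (2 * d - 1) 1 j η hη
    rwa [pow_one] at this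
  · refine Finset.sum_congr rfl fun i _ => ?_
    have := i.isLt
    exact eval_iter _ _ (by simp only [ne_eq, Fin.mk.injEq]; omega) _ _ j η hη

/-- **The specialization computation in Ciliberto's argument (used in the proof of the
residual-point lemma).** Let `k` be a field of characteristic zero, `d ≥ 3`, and
`2d - 2 ≤ q < r`. In the coordinates `Z_0, …, Z_q, Y_{q+1}, …, Y_r` on `ℙ^r` (the
coordinate of index `i` is `Z_i` for `i ≤ q` and `Y_i` for `i > q`), let
`G* = Z_{2d-3}^{2d-1} Y_r + Σ_{i=0}^{2d-4} Z_i^{i+2} Y_r^{2d-2-i}`, let `β*` be the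
point whose only nonzero coordinate is `Y_r = 1`, and let `M₀` be the linear subspace
`{Z_{2d-1} = … = Z_q = Y_{q+1} = … = Y_r = 0}`. Then the point `η* ∈ M₀` whose only
nonzero coordinate is `Z_{2d-2} = 1` satisfies `G*(η*) = 0` and `Δ^j_{η*}(G*)(β*) = 0`
for `j = 1, …, 2d-2`; and conversely `η*` is the unique point of `M₀` with these
properties: any `η ∈ M₀` with `G*(η) = 0` and `Δ^j_η(G*)(β*) = 0` for all
`j = 1, …, 2d-2` is projectively equal to `η*`. -/
theorem stmt_14 (k : Type u) [Field k] [CharZero k] (d q r : ℕ)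
    (hd : 3 ≤ d) (hdq : 2 * d - 2 ≤ q) (hqr : q < r) :
    (MvPolynomial.eval (fun i : Fin (r + 1) => if (i : ℕ) = 2 * d - 2 then 1 else 0)
        ((MvPolynomial.X (⟨2 * d - 3, by omega⟩ : Fin (r + 1))) ^ (2 * d - 1) *
            MvPolynomial.X (⟨r, by omega⟩ : Fin (r + 1)) +
          ∑ i : Fin (2 * d - 3),
            (MvPolynomial.X (⟨(i : ℕ), by have := i.isLt; omega⟩ : Fin (r + 1)))
                ^ ((i : ℕ) + 2) *
              MvPolynomial.X (⟨r, by omega⟩ : Fin (r + 1))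
                ^ (2 * d - 2 - (i : ℕ)) : MvPolynomial (Fin (r + 1)) k)
      = 0) ∧
    (∀ j : ℕ, 1 ≤ j → j ≤ 2 * d - 2 →
      MvPolynomial.eval (fun i : Fin (r + 1) => if (i : ℕ) = r then 1 else 0)
        (polar
          ((MvPolynomial.X (⟨2 * d - 3, by omega⟩ : Fin (r + 1))) ^ (2 * d - 1) *
              MvPolynomial.X (⟨r, by omega⟩ : Fin (r + 1)) +
            ∑ i : Fin (2 * d - 3),
              (MvPolynomial.X (⟨(i : ℕ), by have := i.isLt; omega⟩ : Fin (r + 1)))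
                  ^ ((i : ℕ) + 2) *
                MvPolynomial.X (⟨r, by omega⟩ : Fin (r + 1))
                  ^ (2 * d - 2 - (i : ℕ)) : MvPolynomial (Fin (r + 1)) k)
          (fun i : Fin (r + 1) => if (i : ℕ) = 2 * d - 2 then 1 else 0) j)
        = 0) ∧
    ∀ η : Fin (r + 1) → k, η ≠ 0 →
      (∀ i : Fin (r + 1), 2 * d - 1 ≤ (i : ℕ) → η i = 0) →
      MvPolynomial.eval η
        ((MvPolynomial.X (⟨2 * d - 3, by omega⟩ : Fin (r + 1))) ^ (2 * d - 1) *
            MvPolynomial.X (⟨r, by omega⟩ : Fin (r + 1)) +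
          ∑ i : Fin (2 * d - 3),
            (MvPolynomial.X (⟨(i : ℕ), by have := i.isLt; omega⟩ : Fin (r + 1)))
                ^ ((i : ℕ) + 2) *
              MvPolynomial.X (⟨r, by omega⟩ : Fin (r + 1))
                ^ (2 * d - 2 - (i : ℕ)) : MvPolynomial (Fin (r + 1)) k) = 0 →
      (∀ j : ℕ, 1 ≤ j → j ≤ 2 * d - 2 →
        MvPolynomial.eval (fun i : Fin (r + 1) => if (i : ℕ) = r then 1 else 0)
          (polar
            ((MvPolynomial.X (⟨2 * d - 3, by omega⟩ : Fin (r + 1))) ^ (2 * d - 1) *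
                MvPolynomial.X (⟨r, by omega⟩ : Fin (r + 1)) +
              ∑ i : Fin (2 * d - 3),
                (MvPolynomial.X (⟨(i : ℕ), by have := i.isLt; omega⟩ : Fin (r + 1)))
                    ^ ((i : ℕ) + 2) *
                  MvPolynomial.X (⟨r, by omega⟩ : Fin (r + 1))
                    ^ (2 * d - 2 - (i : ℕ)) : MvPolynomial (Fin (r + 1)) k)
            η j) = 0) →
      ∃ cc : k, cc ≠ 0 ∧
        η = cc • (fun i : Fin (r + 1) =>
          if (i : ℕ) = 2 * d - 2 then (1 : k) else 0) := by
  refine ⟨?_, ?_, ?_⟩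
  · have hr : r ≠ 2 * d - 2 := by omega
    simp only [map_add, map_mul, map_pow, map_sum, MvPolynomial.eval_X, if_neg hr, mul_zero,
      zero_add]
    refine Finset.sum_eq_zero fun i _ => ?_
    have : 2 * d - 2 - (i : ℕ) ≠ 0 := by have := i.isLt; omega
    rw [zero_pow this, mul_zero]
  · intro j _ _
    rw [eval_polar_G d q r hd hdq hqr _ (by omega) (by omega) (fun i => by have := i.isLt; omega)
      (if_neg (by simp only; omega))]
    have h3 : 2 * d - 3 ≠ 2 * d - 2 := by omega
    have h4 : 2 * d - 1 ≠ 0 := by omega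
    simp only [if_neg h3, zero_pow h4, mul_zero, ite_self, zero_add]
    refine Finset.sum_eq_zero fun i _ => ?_
    have h5 : (i : ℕ) ≠ 2 * d - 2 := by have := i.isLt; omega
    simp [h5]
  · intro η hη0 hM _ hpol
    have hr : η ⟨r, by omega⟩ = 0 := hM _ (by simp only; omega)
    have key : ∀ i : Fin (r + 1), (i : ℕ) ≠ 2 * d - 2 → η i = 0 := by
      intro i hi
      by_cases h1 : 2 * d - 1 ≤ (i : ℕ)
      · exact hM i h1
      by_cases h2 : (i : ℕ) = 2 * d - 3
      · have h := hpol 1 le_rfl (by omega)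
        rw [eval_polar_G d q r hd hdq hqr η (by omega) (by omega)
          (fun i => by have := i.isLt; omega) hr, Finset.sum_eq_zero] at h
        · have hi' : i = ⟨2 * d - 3, by omega⟩ := Fin.ext h2
          rw [hi']
          simp only [if_true, Nat.factorial_one, Nat.cast_one, one_mul, add_zero] at h
          exact eq_zero_of_pow_eq_zero h
        · intro x _
          exact if_neg (by have := x.isLt; omega)
      · have h := hpol (2 * d - 2 - (i : ℕ)) (by omega) (by omega)
        rw [eval_polar_G d q r hd hdq hqr η (by omega) (by omega)
          (fun i => by have := i.isLt; omega) hr, if_neg (by omega), zero_add,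
          Finset.sum_eq_single (⟨(i : ℕ), by omega⟩ : Fin (2 * d - 3)), if_pos rfl] at h
        · rcases mul_eq_zero.mp h with h | h
          · exact absurd h (Nat.cast_ne_zero.mpr (Nat.factorial_ne_zero _))
          · exact eq_zero_of_pow_eq_zero h
        · intro x _ hx
          have hx' : (x : ℕ) ≠ i := fun h => hx (Fin.ext h)
          exact if_neg (by have := x.isLt; omega)
        · intro h; exact absurd (Finset.mem_univ _) h
    refine ⟨η ⟨2 * d - 2, by omega⟩, ?_, ?_⟩
    · intro h
      apply hη0
      funext i
      by_cases hi : (i : ℕ) = 2 * d - 2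
      · have hi' : i = ⟨2 * d - 2, by omega⟩ := Fin.ext hi
        rw [hi', h]; rfl
      · exact key i hi
    · funext i
      by_cases hi : (i : ℕ) = 2 * d - 2
      · have hi' : i = ⟨2 * d - 2, by omega⟩ := Fin.ext hi
        simp [hi']
      · simp [hi, key i hi]
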